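/- Let X be a compact metric space, f : X → X a continuous map with the s-limit shadowing property, C a chain component of f, D ∈ 𝒟(C), and ℱ, 𝒢 full Furstenberg families. For any n ≥ 2 and δ > 0, if there exists an (ℱ,𝒢)-δ-scrambled n-tuple (a_1,…,a_n) ∈ [V^s(D)]^n for f, then for every 0 < r < δ, V^s(D) is dense (ℱ,𝒢)-n-r-chaotic for f. -/

import Mathlib

open Filter Metric Set Topology

section Defs

variable {X : Type*} [MetricSpace X]

/-- A δ-chain of `f` of length `k` (with `k ≥ 1`) within the set `C`, from `x` to `y`. -/
def ChainIn (f : X → X) (C : Set X) (δ : ℝ) (k : ℕ) (x y : X) : Prop :=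
  1 ≤ k ∧ ∃ c : ℕ → X, c 0 = x ∧ c k = y ∧ (∀ i ≤ k, c i ∈ C) ∧
    ∀ i < k, dist (f (c i)) (c (i + 1)) ≤ δ

/-- `x → y` : for every `δ > 0` there is a `δ`-chain of `f` from `x` to `y`. -/
def ChainReach (f : X → X) (x y : X) : Prop :=
  ∀ δ > 0, ∃ k, ChainIn f Set.univ δ k x y

/-- `x` is chain recurrent for `f`. -/
def ChainRecurrent (f : X → X) (x : X) : Prop := ChainReach f x x

/-- `C` is a chain component of `f`: an equivalence class of the relation `↔`
on the set of chain recurrent points. -/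
def IsChainComponent (f : X → X) (C : Set X) : Prop :=
  ∃ x, ChainRecurrent f x ∧
    C = {y | ChainRecurrent f y ∧ ChainReach f x y ∧ ChainReach f y x}

/-- The set of lengths of δ-cycles of `f` restricted to `C`. -/
def cycleLengths (f : X → X) (C : Set X) (δ : ℝ) : Set ℕ :=
  {k | ∃ x ∈ C, ChainIn f C δ k x x}

/-- The greatest common divisor of a set of natural numbers
(the greatest natural number dividing every element). -/
noncomputable def setGcd (S : Set ℕ) : ℕ := sSup {d | ∀ k ∈ S, d ∣ k}

/-- `x ∼_{C,δ} y` : there is a δ-chain of `f|_C` from `x` to `y` whose length is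
divisible by `m(C,δ)`, the gcd of the lengths of all δ-cycles of `f|_C`. -/
def SimCd (f : X → X) (C : Set X) (δ : ℝ) (x y : X) : Prop :=
  ∃ k, setGcd (cycleLengths f C δ) ∣ k ∧ ChainIn f C δ k x y

/-- `x ∼_C y` : `x ∼_{C,δ} y` for all `δ > 0`. -/
def SimC (f : X → X) (C : Set X) (x y : X) : Prop :=
  ∀ δ > 0, SimCd f C δ x y

/-- `𝒟(C,δ)` : the set of equivalence classes of `∼_{C,δ}`. -/
def DClassesd (f : X → X) (C : Set X) (δ : ℝ) : Set (Set X) :=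
  {D | ∃ x ∈ C, D = {y ∈ C | SimCd f C δ x y}}

/-- `𝒟(C)` : the set of equivalence classes of `∼_C`. -/
def DClasses (f : X → X) (C : Set X) : Set (Set X) :=
  {D | ∃ x ∈ C, D = {y ∈ C | SimC f C x y}}

/-- `W^s(C) = {x : lim_{i→∞} d(f^i(x), C) = 0}`. -/
def wStable (f : X → X) (C : Set X) : Set X :=
  {x | Tendsto (fun i => infDist (f^[i] x) C) atTop (nhds 0)}

/-- `V^s(D) = ⋂_{δ>0} {x ∈ W^s(C) : lim_{i→∞} d(f^i(x), f^i(D_δ)) = 0}`, where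
`D_δ` is the unique element of `𝒟(C,δ)` containing `D`. -/
def vStable (f : X → X) (C D : Set X) : Set X :=
  {x | x ∈ wStable f C ∧ ∀ δ > 0, ∀ Dd ∈ DClassesd f C δ, D ⊆ Dd →
    Tendsto (fun i => infDist (f^[i] x) (f^[i] '' Dd)) atTop (nhds 0)}

/-- The s-limit shadowing property. -/
def SLimitShadowing (f : X → X) : Prop :=
  ∀ ε > 0, ∃ δ > 0, ∀ x : ℕ → X,
    (∀ i, dist (f (x i)) (x (i + 1)) ≤ δ) →
    Tendsto (fun i => dist (f (x i)) (x (i + 1))) atTop (nhds 0) →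
    ∃ z : X, (∀ i, dist (f^[i] z) (x i) ≤ ε) ∧
      Tendsto (fun i => dist (f^[i] z) (x i)) atTop (nhds 0)

/-- The limit shadowing property. -/
def LimitShadowing (f : X → X) : Prop :=
  ∀ x : ℕ → X, Tendsto (fun i => dist (f (x i)) (x (i + 1))) atTop (nhds 0) →
    ∃ z : X, Tendsto (fun i => dist (f^[i] z) (x i)) atTop (nhds 0)

/-- The (plain) shadowing property. -/
def ShadowingProperty (f : X → X) : Prop :=
  ∀ ε > 0, ∃ δ > 0, ∀ x : ℕ → X, (∀ i, dist (f (x i)) (x (i + 1)) ≤ δ) →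
    ∃ z : X, ∀ i, dist (f^[i] z) (x i) ≤ ε

/-- A Furstenberg family: hereditary upward and proper. -/
def FurstenbergFamily (F : Set (Set ℕ)) : Prop :=
  (∀ A B : Set ℕ, A ∈ F → A ⊆ B → B ∈ F) ∧ F.Nonempty ∧ F ≠ Set.univ

/-- A full Furstenberg family. -/
def FullFamily (F : Set (Set ℕ)) : Prop :=
  ∀ A ∈ F, ∀ n : ℕ, {i ∈ A | n ≤ i} ∈ F

/-- A translation invariant Furstenberg family. -/
def TranslationInvariantFamily (F : Set (Set ℕ)) : Prop :=
  ∀ A ∈ F, ∀ n : ℕ, ((fun i => i + n) '' A ∈ F ∧ {i | i + n ∈ A} ∈ F)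

/-- `S_f(x₁,…,xₙ; r) = {i : min_{j<k} d(fⁱ(x_j), fⁱ(x_k)) > r}`. -/
def Sset (f : X → X) {n : ℕ} (x : Fin n → X) (r : ℝ) : Set ℕ :=
  {i | ∀ j k : Fin n, j < k → r < dist (f^[i] (x j)) (f^[i] (x k))}

/-- `T_f(x₁,…,xₙ; r) = {i : max_{j<k} d(fⁱ(x_j), fⁱ(x_k)) < r}`. -/
def Tset (f : X → X) {n : ℕ} (x : Fin n → X) (r : ℝ) : Set ℕ :=
  {i | ∀ j k : Fin n, j < k → dist (f^[i] (x j)) (f^[i] (x k)) < r}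

/-- `(x₁,…,xₙ)` is an `(ℱ,𝒢)`-δ-scrambled n-tuple for `f`. -/
def Scrambled (f : X → X) (F G : Set (Set ℕ)) (δ : ℝ) {n : ℕ} (x : Fin n → X) : Prop :=
  Sset f x δ ∈ F ∧ ∀ ε > 0, Tset f x ε ∈ G

/-- `Y` is dense `(ℱ,𝒢)`-n-δ-chaotic for `f`: the `(ℱ,𝒢)`-δ-scrambled n-tuples in `Yⁿ`
form a dense subset of `Yⁿ`. -/
def DenseChaotic (f : X → X) (F G : Set (Set ℕ)) (n : ℕ) (δ : ℝ) (Y : Set X) : Prop :=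
  {x : Fin n → X | ∀ j, x j ∈ Y} ⊆
    closure {x : Fin n → X | (∀ j, x j ∈ Y) ∧ Scrambled f F G δ x}

/-- `S` is a residual subset of the subspace `T`: it contains a countable intersection of
dense open subsets of `T`. -/
def ResidualIn {α : Type*} [TopologicalSpace α] (T S : Set α) : Prop :=
  ∃ U : ℕ → Set α, (∀ i, IsOpen (U i)) ∧ (∀ i, T ⊆ closure (U i ∩ T)) ∧
    (⋂ i, U i) ∩ T ⊆ S

/-- `Y` is generic `(ℱ,𝒢)`-n-δ-chaotic for `f`: the `(ℱ,𝒢)`-δ-scrambled n-tuples in `Yⁿ`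
form a residual subset of `Yⁿ`. -/
def GenericChaotic (f : X → X) (F G : Set (Set ℕ)) (n : ℕ) (δ : ℝ) (Y : Set X) : Prop :=
  ResidualIn {x : Fin n → X | ∀ j, x j ∈ Y}
    {x : Fin n → X | (∀ j, x j ∈ Y) ∧ Scrambled f F G δ x}

/-- A Furstenberg family `F` is compatible with `(Z, g)`. -/
def CompatibleFamily {Z : Type*} [TopologicalSpace Z] (F : Set (Set ℕ)) (g : Z → Z) : Prop :=
  ∀ U : Set Z, IsOpen U → IsGδ {z | {i | g^[i] z ∈ U} ∈ F}

end Defs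

section Chains

variable {X : Type*} [MetricSpace X] {f : X → X} {C : Set X}

namespace ChainIn

theorem trans {δ : ℝ} {k l : ℕ} {x y z : X} (h₁ : ChainIn f C δ k x y)
    (h₂ : ChainIn f C δ l y z) : ChainIn f C δ (k + l) x z := by
  obtain ⟨hk, c, c0, ck, cC, cd⟩ := h₁
  obtain ⟨hl, e, e0, el, eC, ed⟩ := h₂
  refine ⟨by omega, fun i => if i < k then c i else e (i - k), ?_, ?_, ?_, ?_⟩
  · simp only [if_pos (show 0 < k by omega), c0]
  · simp [el]
  · intro i hi
    dsimp only
    split_ifs with h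
    · exact cC i h.le
    · exact eC _ (by omega)
  · intro i hi
    dsimp only
    by_cases h : i + 1 < k
    · rw [if_pos (by omega), if_pos h]
      exact cd i (by omega)
    · by_cases h' : i < k
      · rw [if_pos h', if_neg h, show i + 1 - k = 0 by omega, e0, ← ck,
          show k = i + 1 by omega]
        exact cd i h'
      · rw [if_neg h', if_neg h, show i + 1 - k = i - k + 1 by omega]
        exact ed _ (by omega)

theorem mono {δ δ' : ℝ} (hδ : δ ≤ δ') {k : ℕ} {x y : X} (h : ChainIn f C δ k x y) :
    ChainIn f C δ' k x y := by
  obtain ⟨hk, c, c0, ck, cC, cd⟩ := h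
  exact ⟨hk, c, c0, ck, cC, fun i hi => (cd i hi).trans hδ⟩

/-- The last point of a chain may be moved at the cost of enlarging the error. -/
theorem move_end {δ ε : ℝ} (hε : 0 ≤ ε) {k : ℕ} {x y z : X} (h : ChainIn f C δ k x y)
    (hz : z ∈ C) (hd : dist y z ≤ ε) : ChainIn f C (δ + ε) k x z := by
  obtain ⟨hk, c, c0, ck, cC, cd⟩ := h
  refine ⟨hk, fun i => if i = k then z else c i, ?_, by simp, ?_, ?_⟩
  · simp only [if_neg (show 0 ≠ k by omega), c0]
  · intro i hi
    dsimp only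
    split_ifs
    · exact hz
    · exact cC i hi
  · intro i hi
    dsimp only
    rw [if_neg (by omega)]
    have := cd i hi
    split_ifs with h
    · rw [h, ck] at this
      exact (dist_triangle _ y _).trans (add_le_add this hd)
    · linarith

/-- The first point of a chain may be moved at the cost of enlarging the error. -/
theorem move_start {δ ε : ℝ} (hε : 0 ≤ ε) {k : ℕ} {x y z : X} (h : ChainIn f C δ k x y)
    (hz : z ∈ C) (hd : dist (f z) (f x) ≤ ε) : ChainIn f C (δ + ε) k z y := by
  obtain ⟨hk, c, c0, ck, cC, cd⟩ := h
  refine ⟨hk, fun i => if i = 0 then z else c i, by simp, ?_, ?_, ?_⟩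
  · simp only [if_neg (show k ≠ 0 by omega), ck]
  · intro i hi
    dsimp only
    split_ifs
    · exact hz
    · exact cC i hi
  · intro i hi
    dsimp only
    rw [if_neg (show i + 1 ≠ 0 by omega)]
    have := cd i hi
    split_ifs with h
    · subst h
      rw [c0] at this
      linarith [dist_triangle (f z) (f x) (c (0 + 1))]
    · linarith

theorem iterate (hfC : MapsTo f C C) {δ : ℝ} (hδ : 0 ≤ δ) {x : X} (hx : x ∈ C) {k : ℕ}
    (hk : 1 ≤ k) : ChainIn f C δ k x (f^[k] x) := by
  refine ⟨hk, fun i => f^[i] x, rfl, rfl, fun i _ => hfC.iterate i hx, fun i _ => ?_⟩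
  simpa only [Function.iterate_succ_apply', dist_self] using hδ

end ChainIn

theorem ChainReach.trans {x y z : X} (h₁ : ChainReach f x y) (h₂ : ChainReach f y z) :
    ChainReach f x z := fun δ hδ => by
  obtain ⟨k, hk⟩ := h₁ δ hδ
  obtain ⟨l, hl⟩ := h₂ δ hδ
  exact ⟨k + l, hk.trans hl⟩

theorem chainReach_apply (f : X → X) (x : X) : ChainReach f x (f x) := fun _ hδ =>
  ⟨1, ChainIn.iterate (mapsTo_univ _ _) hδ.le (mem_univ x) le_rfl⟩

theorem ChainRecurrent.apply_chainReach (hf : Continuous f) {x : X}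
    (hx : ChainRecurrent f x) : ChainReach f (f x) x := by
  intro δ hδ
  obtain ⟨ε, hε, hεf⟩ := Metric.continuous_iff.1 hf (f x) (δ / 2) (half_pos hδ)
  obtain ⟨k, hk⟩ := hx (min (ε / 2) (δ / 2)) (by positivity)
  obtain ⟨hl, c, c0, ck, -, cd⟩ := hk.trans hk
  have hk1 := hk.1
  have h1 : dist (c 1) (f x) < ε := by
    have := cd 0 (by omega)
    rw [c0, zero_add, dist_comm] at this
    linarith [min_le_left (ε / 2) (δ / 2)]
  have htail : ChainIn f univ (δ / 2) (k + k - 1) (c 1) x := by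
    refine ⟨by omega, fun i => c (i + 1), rfl, ?_, fun _ _ => mem_univ _, fun i hi => ?_⟩
    · simp only [Nat.sub_add_cancel hl, ck]
    · exact (cd (i + 1) (by omega)).trans (min_le_right _ _)
  refine ⟨_, (htail.move_start (half_pos hδ).le (mem_univ (f x)) ?_).mono
    (add_halves δ).le⟩
  rw [dist_comm]
  exact (hεf _ h1).le

namespace IsChainComponent

theorem chainReach (hC : IsChainComponent f C) {u v : X} (hu : u ∈ C) (hv : v ∈ C) :
    ChainReach f u v := by
  obtain ⟨x, -, rfl⟩ := hC
  exact hu.2.2.trans hv.2.1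

theorem mem_of_chainReach (hC : IsChainComponent f C) {u v : X} (hu : u ∈ C)
    (huv : ChainReach f u v) (hvu : ChainReach f v u) : v ∈ C := by
  obtain ⟨x, -, rfl⟩ := hC
  exact ⟨hvu.trans huv, hu.2.1.trans huv, hvu.trans hu.2.2⟩

theorem mapsTo (hC : IsChainComponent f C) (hf : Continuous f) : MapsTo f C C := fun u hu =>
  hC.mem_of_chainReach hu (chainReach_apply f u)
    (ChainRecurrent.apply_chainReach hf (hC.chainReach hu hu))

/-- Fine enough chains that leave a point of a chain component and come back to it stay near
the component. -/
theorem exists_near [CompactSpace X] (hC : IsChainComponent f C) (hf : Continuous f) {u : X}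
    (hu : u ∈ C) {ε : ℝ} (hε : 0 < ε) :
    ∃ δ > 0, ∀ z, (∃ k, ChainIn f univ δ k u z) → (∃ k, ChainIn f univ δ k z u) →
      ∃ y ∈ C, dist z y < ε := by
  by_contra! hcon
  choose z hz₁ hz₂ hz₃ using fun n : ℕ => hcon (1 / ((n : ℝ) + 1)) Nat.one_div_pos_of_nat
  obtain ⟨w, -, φ, hφ, hw⟩ := isCompact_univ.tendsto_subseq (fun n => mem_univ (z n))
  have hdist : Tendsto (fun n => dist (z (φ n)) w) atTop (𝓝 0) :=
    tendsto_iff_dist_tendsto_zero.1 hw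
  have hfdist : Tendsto (fun n => dist (f (z (φ n))) (f w)) atTop (𝓝 0) :=
    tendsto_iff_dist_tendsto_zero.1 ((hf.tendsto w).comp hw)
  have hsmall : Tendsto (fun n => 1 / ((φ n : ℝ) + 1)) atTop (𝓝 0) :=
    tendsto_one_div_add_atTop_nhds_zero_nat.comp hφ.tendsto_atTop
  have hwC : w ∈ C := by
    refine hC.mem_of_chainReach hu (fun δ hδ => ?_) (fun δ hδ => ?_)
    · obtain ⟨n, h₁, h₂⟩ := ((hdist.eventually_lt_const (half_pos hδ)).and
        (hsmall.eventually_lt_const (half_pos hδ))).exists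
      obtain ⟨k, hk⟩ := hz₁ (φ n)
      exact ⟨k, (hk.move_end (half_pos hδ).le (mem_univ w) h₁.le).mono (by linarith)⟩
    · obtain ⟨n, h₁, h₂⟩ := ((hfdist.eventually_lt_const (half_pos hδ)).and
        (hsmall.eventually_lt_const (half_pos hδ))).exists
      obtain ⟨k, hk⟩ := hz₂ (φ n)
      rw [dist_comm] at h₁
      exact ⟨k, (hk.move_start (half_pos hδ).le (mem_univ w) h₁.le).mono (by linarith)⟩
  obtain ⟨n, hn⟩ := (hdist.eventually_lt_const hε).exists
  exact absurd hn (not_lt.2 (hz₃ (φ n) w hwC))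

/-- The restriction of `f` to a chain component is chain transitive. -/
theorem exists_chainIn [CompactSpace X] (hC : IsChainComponent f C) (hf : Continuous f)
    {u v : X} (hu : u ∈ C) (hv : v ∈ C) {δ : ℝ} (hδ : 0 < δ) :
    ∃ k, ChainIn f C δ k u v := by
  obtain ⟨ε₀, hε₀, hfε⟩ := Metric.uniformContinuous_iff.1
    (CompactSpace.uniformContinuous_of_continuous hf) (δ / 3) (by positivity)
  obtain ⟨δ', hδ', hnear⟩ := hC.exists_near hf hu
    (show 0 < min ε₀ (δ / 3) by positivity)
  have hpos : 0 < min δ' (δ / 3) := by positivity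
  obtain ⟨k, hk, c, c0, ck, -, cd⟩ := hC.chainReach hu hv _ hpos
  obtain ⟨l, hl⟩ := hC.chainReach hv hu _ hpos
  have key : ∀ i, ∃ y, i ≤ k →
      y ∈ C ∧ dist (c i) y < min ε₀ (δ / 3) ∧ (c i ∈ C → y = c i) := by
    intro i
    by_cases hi : i ≤ k
    swap
    · exact ⟨u, fun h => absurd h hi⟩
    by_cases hiC : c i ∈ C
    · exact ⟨c i, fun _ => ⟨hiC, by rw [dist_self]; positivity, fun _ => rfl⟩⟩
    have hi0 : i ≠ 0 := by
      rintro rfl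
      exact hiC (c0 ▸ hu)
    have hik : i ≠ k := by
      rintro rfl
      exact hiC (ck ▸ hv)
    have h₁ : ChainIn f univ (min δ' (δ / 3)) i u (c i) :=
      ⟨by omega, c, c0, rfl, fun _ _ => mem_univ _, fun j hj => cd j (by omega)⟩
    have h₂ : ChainIn f univ (min δ' (δ / 3)) (k - i) (c i) v := by
      refine ⟨by omega, fun j => c (j + i), by simp, ?_, fun _ _ => mem_univ _,
        fun j hj => ?_⟩
      · simp only [Nat.sub_add_cancel hi, ck]
      · have := cd (j + i) (by omega)
        rwa [Nat.add_right_comm] at this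
    obtain ⟨y, hy, hd⟩ := hnear (c i) ⟨_, h₁.mono (min_le_left _ _)⟩
      ⟨_, (h₂.trans hl).mono (min_le_left _ _)⟩
    exact ⟨y, fun _ => ⟨hy, hd, fun h => absurd h hiC⟩⟩
  choose e he using key
  refine ⟨k, hk, e, ?_, ?_, fun i hi => (he i hi).1, fun i hi => ?_⟩
  · rw [(he 0 (by omega)).2.2 (c0 ▸ hu), c0]
  · rw [(he k le_rfl).2.2 (ck ▸ hv), ck]
  · have h₁ := hfε ((he i hi.le).2.1.trans_le (min_le_left _ _))
    have h₂ := (he (i + 1) hi).2.1.trans_le (min_le_right _ _)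
    have h₃ := (cd i hi).trans (min_le_right _ _)
    rw [dist_comm] at h₁
    linarith [dist_triangle4 (f (e i)) (f (c i)) (c (i + 1)) (e (i + 1))]

end IsChainComponent

theorem setGcd_dvd {S : Set ℕ} {s : ℕ} (hs : s ∈ S) (hs0 : 0 < s) {k : ℕ} (hk : k ∈ S) :
    setGcd S ∣ k :=
  Nat.sSup_mem (s := {d | ∀ k ∈ S, d ∣ k}) ⟨1, fun _ _ => one_dvd _⟩
    ⟨s, fun _ hd => Nat.le_of_dvd hs0 (hd s hs)⟩ k hk

theorem le_setGcd {S : Set ℕ} {s : ℕ} (hs : s ∈ S) (hs0 : 0 < s) {d : ℕ}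
    (hd : ∀ k ∈ S, d ∣ k) : d ≤ setGcd S :=
  le_csSup (s := {d | ∀ k ∈ S, d ∣ k}) ⟨s, fun _ hd => Nat.le_of_dvd hs0 (hd s hs)⟩ hd

/-- Every sufficiently large multiple of the gcd of the lengths of all `δ`-cycles in a chain
component is the length of a `δ`-cycle through a given point. -/
theorem IsChainComponent.exists_cycle_of_ge [CompactSpace X] (hC : IsChainComponent f C)
    (hf : Continuous f) {p : X} (hp : p ∈ C) {δ : ℝ} (hδ : 0 < δ) :
    ∃ K, ∀ k ≥ K, setGcd (cycleLengths f C δ) ∣ k → ChainIn f C δ k p p := by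
  obtain ⟨s, hs⟩ := hC.exists_chainIn hf hp hp hδ
  set P : Set ℕ := {k | ChainIn f C δ k p p}
  have hs0 : 0 < s := hs.1
  have hsS : s ∈ cycleLengths f C δ := ⟨p, hp, hs⟩
  have hdvd : ∀ k ∈ cycleLengths f C δ, Nat.setGcd P ∣ k := by
    rintro k ⟨x, hx, hk⟩
    obtain ⟨i, hi⟩ := hC.exists_chainIn hf hp hx hδ
    obtain ⟨j, hj⟩ := hC.exists_chainIn hf hx hp hδ
    have h₁ : Nat.setGcd P ∣ i + j := Nat.setGcd_dvd_of_mem (hi.trans hj)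
    have h₂ : Nat.setGcd P ∣ i + k + j := Nat.setGcd_dvd_of_mem ((hi.trans hk).trans hj)
    rw [Nat.add_right_comm] at h₂
    exact (Nat.dvd_add_right h₁).1 h₂
  have hle : Nat.setGcd P ≤ setGcd (cycleLengths f C δ) := le_setGcd hsS hs0 hdvd
  have hdvd' : setGcd (cycleLengths f C δ) ∣ Nat.setGcd P :=
    Nat.dvd_setGcd_iff.2 fun k hk => setGcd_dvd hsS hs0 ⟨p, hp, hk⟩
  have heq : setGcd (cycleLengths f C δ) = Nat.setGcd P :=
    le_antisymm (Nat.le_of_dvd (Nat.pos_of_dvd_of_pos (hdvd s hsS) hs0) hdvd') hle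
  obtain ⟨K, hK⟩ := Nat.exists_mem_closure_of_ge P
  have hclos : ∀ k ∈ AddSubmonoid.closure P, k = 0 ∨ ChainIn f C δ k p p := by
    intro k hk
    induction hk using AddSubmonoid.closure_induction with
    | mem x hx => exact Or.inr hx
    | zero => exact Or.inl rfl
    | add x y _ _ hx hy =>
      rcases hx with rfl | hx
      · rwa [zero_add]
      · rcases hy with rfl | hy
        · exact Or.inr hx
        · exact Or.inr (hx.trans hy)
  refine ⟨max K 1, fun k hk hd => ?_⟩
  refine (hclos k (hK k (le_trans (le_max_left _ _) hk) (heq ▸ hd))).resolve_left ?_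
  have := (le_max_right K 1).trans hk
  omega

/-- Two points of `V^s(D)` are joined by a pseudo-orbit that starts at the first one and
eventually agrees, at equal times, with the orbit of the second one. -/
theorem exists_pseudoOrbit [CompactSpace X] (hC : IsChainComponent f C) (hf : Continuous f)
    {D : Set X} (hD : D ∈ DClasses f C) {y a : X} (hy : y ∈ vStable f C D)
    (ha : a ∈ vStable f C D) {η : ℝ} (hη : 0 < η) :
    ∃ x : ℕ → X, x 0 = y ∧ (∀ i, dist (f (x i)) (x (i + 1)) ≤ η) ∧
      ∃ M, ∀ i ≥ M, x i = f^[i] a := by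
  obtain ⟨x₀, hx₀, rfl⟩ := hD
  have hη2 : 0 < η / 2 := half_pos hη
  have hη4 : 0 < η / 2 / 2 := half_pos hη2
  set E : Set X := {z ∈ C | SimCd f C (η / 2) x₀ z}
  have hEmem : E ∈ DClassesd f C (η / 2) := ⟨x₀, hx₀, rfl⟩
  have hDE : {z ∈ C | SimC f C x₀ z} ⊆ E := fun z hz => ⟨hz.1, hz.2 _ hη2⟩
  set m := setGcd (cycleLengths f C (η / 2))
  obtain ⟨s, hs⟩ := hC.exists_chainIn hf hx₀ hx₀ hη2
  have hs0 : 0 < s := hs.1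
  have hsS : s ∈ cycleLengths f C (η / 2) := ⟨x₀, hx₀, hs⟩
  have hcyc : ∀ {z k}, z ∈ C → ChainIn f C (η / 2) k z z → m ∣ k := fun hz hk =>
    setGcd_dvd hsS hs0 ⟨_, hz, hk⟩
  have hm0 : 0 < m := Nat.pos_of_dvd_of_pos (hcyc hx₀ hs) hs0
  have hx₀E : x₀ ∈ E := ⟨hx₀, s, hcyc hx₀ hs, hs⟩
  have hfC := hC.mapsTo hf
  obtain ⟨N, hN1, hN⟩ := ((eventually_ge_atTop 1).and
    ((hy.2 _ hη2 E hEmem hDE).eventually_lt_const hη2)).exists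
  obtain ⟨_, ⟨p, ⟨hpC, t₁, ht₁m, ht₁⟩, rfl⟩, hp⟩ :=
    (infDist_lt_iff ⟨_, mem_image_of_mem _ hx₀E⟩).1 hN
  -- a point of `C` near which the orbit of `a` returns at arbitrarily large multiples of `m`
  obtain ⟨w₀, -, φ, hφ, hw₀⟩ :=
    isCompact_univ.tendsto_subseq (fun i : ℕ => mem_univ (f^[i * m] a))
  have hτ : Tendsto (fun i => φ i * m) atTop atTop :=
    hφ.tendsto_atTop.atTop_mul_const' hm0
  have hw₀C : infDist w₀ C < η / 2 / 2 / 2 := by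
    have h₁ := (continuous_infDist_pt C).continuousAt.tendsto.comp hw₀
    have h₂ := ha.1.comp hτ
    rw [tendsto_nhds_unique h₁ h₂]
    exact half_pos hη4
  obtain ⟨w, hwC, hw⟩ := (infDist_lt_iff ⟨x₀, hx₀⟩).1 hw₀C
  have hret : ∀ᶠ i in atTop, dist (f^[φ i * m] a) w < η / 2 / 2 := by
    filter_upwards [(tendsto_iff_dist_tendsto_zero.1 hw₀).eventually_lt_const
      (half_pos hη4)] with i hi
    have hi' : dist (f^[φ i * m] a) w₀ < η / 2 / 2 / 2 := hi
    linarith [dist_triangle (f^[φ i * m] a) w₀ w]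
  obtain ⟨j, hj₁, hjw, hjE⟩ := ((hτ.eventually_ge_atTop 1).and (hret.and
    (hτ.eventually ((ha.2 _ hη2 E hEmem hDE).eventually_lt_const hη4)))).exists
  obtain ⟨_, ⟨q, ⟨hqC, t₂, ht₂m, ht₂⟩, rfl⟩, hq⟩ :=
    (infDist_lt_iff ⟨_, mem_image_of_mem _ hx₀E⟩).1 hjE
  have hqw : ChainIn f C (η / 2) (φ j * m) q w := by
    have h := (ChainIn.iterate hfC le_rfl hqC hj₁).move_end hη2.le hwC (by
      rw [dist_comm] at hq
      linarith [dist_triangle (f^[φ j * m] q) (f^[φ j * m] a) w])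
    rwa [zero_add] at h
  have hpN : ChainIn f C (η / 2) N p (f^[N] p) := ChainIn.iterate hfC hη2.le hpC hN1
  obtain ⟨s₁, hs₁⟩ := hC.exists_chainIn hf (hfC.iterate N hpC) hpC hη2
  obtain ⟨s₂, hs₂⟩ := hC.exists_chainIn hf hpC hx₀ hη2
  have hd₁ : m ∣ N + s₁ := hcyc hpC (hpN.trans hs₁)
  have hd₂ : m ∣ s₂ := (Nat.dvd_add_left ht₁m).1 (hcyc hpC (hs₂.trans ht₁))
  obtain ⟨K, hK⟩ := hC.exists_cycle_of_ge hf hpC hη2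
  obtain ⟨i, hiM, hiw⟩ := ((hτ.eventually_ge_atTop
    (K + N + s₁ + s₂ + t₂ + φ j * m)).and hret).exists
  set M := φ i * m with hM
  obtain ⟨L, hL⟩ : ∃ L, M = L + (N + s₁ + s₂ + t₂ + φ j * m) :=
    ⟨M - (N + s₁ + s₂ + t₂ + φ j * m), by omega⟩
  have hLm : m ∣ L := by
    have h : m ∣ N + s₁ + s₂ + t₂ + φ j * m :=
      (((hd₁.add hd₂).add ht₂m).add (Dvd.intro_left _ rfl))
    exact (Nat.dvd_add_left h).1 (hL ▸ Dvd.intro_left _ rfl)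
  obtain ⟨hl, c, c0, cl, -, cd⟩ := (((hs₁.trans (hK L (by omega) hLm)).trans hs₂).trans
    ht₂).trans hqw
  set l := s₁ + L + s₂ + t₂ + φ j * m with hl'
  have hMl : M = N + l := by omega
  refine ⟨fun k => if k < N then f^[k] y else if k < M then c (k - N) else f^[k] a, ?_, ?_,
    M, fun k hk => ?_⟩
  · simp only [if_pos (show 0 < N by omega), Function.iterate_zero, id]
  · intro k
    dsimp only
    rcases lt_trichotomy (k + 1) N with h | h | h
    · rw [if_pos (by omega), if_pos h, Function.iterate_succ_apply', dist_self]
      exact hη.le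
    · rw [if_pos (by omega), if_neg (by omega), if_pos (by omega),
        ← Function.iterate_succ_apply' f, Nat.succ_eq_add_one, h, Nat.sub_self, c0]
      exact hp.le.trans (half_le_self hη.le)
    · rw [if_neg (show ¬k < N by omega), if_neg (show ¬k + 1 < N by omega)]
      rcases lt_trichotomy (k + 1) M with h' | h' | h'
      · rw [if_pos (by omega), if_pos h', show k + 1 - N = k - N + 1 by omega]
        exact (cd _ (by omega)).trans (half_le_self hη.le)
      · rw [if_pos (by omega), if_neg (by omega), h']
        have h₁ := cd (k - N) (by omega)
        rw [show k - N + 1 = l by omega, cl] at h₁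
        rw [dist_comm] at hiw
        linarith [dist_triangle (f (c (k - N))) w (f^[M] a)]
      · rw [if_neg (by omega), if_neg (by omega), Function.iterate_succ_apply', dist_self]
        exact hη.le
  · simp only [if_neg (show ¬k < N by omega), if_neg (not_lt.2 hk)]

/-- `V^s(D)` contains every point asymptotic to one of its points. -/
theorem vStable_of_asymptotic {D : Set X} {a z : X} (ha : a ∈ vStable f C D)
    (hz : Tendsto (fun i => dist (f^[i] z) (f^[i] a)) atTop (𝓝 0)) : z ∈ vStable f C D := by
  have key : ∀ S : ℕ → Set X, Tendsto (fun i => infDist (f^[i] a) (S i)) atTop (𝓝 0) →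
      Tendsto (fun i => infDist (f^[i] z) (S i)) atTop (𝓝 0) := fun S hS =>
    squeeze_zero (fun _ => infDist_nonneg) (fun _ => infDist_le_infDist_add_dist)
      (by simpa only [add_zero] using hS.add hz)
  exact ⟨key _ ha.1, fun δ hδ E hE hDE => key _ (ha.2 δ hδ E hE hDE)⟩

/-- Scrambledness passes to asymptotic tuples, with a slightly smaller separation constant. -/
theorem Scrambled.of_asymptotic {F G : Set (Set ℕ)} (hF : FurstenbergFamily F)
    (hFfull : FullFamily F) (hG : FurstenbergFamily G) (hGfull : FullFamily G) {n : ℕ}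
    {r δ : ℝ} (hrδ : r < δ) {a z : Fin n → X} (ha : Scrambled f F G δ a)
    (hz : ∀ j, Tendsto (fun i => dist (f^[i] (z j)) (f^[i] (a j))) atTop (𝓝 0)) :
    Scrambled f F G r z := by
  have hclose : ∀ ε > 0, ∃ N, ∀ i ≥ N, ∀ j, dist (f^[i] (z j)) (f^[i] (a j)) < ε :=
    fun ε hε => eventually_atTop.1
      (eventually_all.2 fun j => (hz j).eventually_lt_const hε)
  refine ⟨?_, fun ε hε => ?_⟩
  · obtain ⟨N, hN⟩ := hclose ((δ - r) / 2) (by linarith)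
    refine hF.1 _ _ (hFfull _ ha.1 N) fun i ⟨hi, hNi⟩ j k hjk => ?_
    have h₁ := hN i hNi j
    rw [dist_comm] at h₁
    linarith [hi j k hjk, hN i hNi k,
      dist_triangle4 (f^[i] (a j)) (f^[i] (z j)) (f^[i] (z k)) (f^[i] (a k))]
  · obtain ⟨N, hN⟩ := hclose (ε / 3) (by positivity)
    refine hG.1 _ _ (hGfull _ (ha.2 (ε / 3) (by positivity)) N)
      fun i ⟨hi, hNi⟩ j k hjk => ?_
    have h₁ := hN i hNi k
    rw [dist_comm] at h₁
    linarith [hi j k hjk, hN i hNi j,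
      dist_triangle4 (f^[i] (z j)) (f^[i] (a j)) (f^[i] (a k)) (f^[i] (z k))]

/-- Every point of `V^s(D)` is a limit of points asymptotic to a prescribed point of
`V^s(D)`. -/
theorem exists_asymptotic_near [CompactSpace X] (hC : IsChainComponent f C)
    (hf : Continuous f) (hsls : SLimitShadowing f) {D : Set X} (hD : D ∈ DClasses f C)
    {y a : X} (hy : y ∈ vStable f C D) (ha : a ∈ vStable f C D) {ε : ℝ} (hε : 0 < ε) :
    ∃ z, dist z y ≤ ε ∧ Tendsto (fun i => dist (f^[i] z) (f^[i] a)) atTop (𝓝 0) := by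
  obtain ⟨η, hη, hshadow⟩ := hsls ε hε
  obtain ⟨x, hx0, hx, M, hM⟩ := exists_pseudoOrbit hC hf hD hy ha hη
  obtain ⟨z, hz, hz'⟩ := hshadow x hx (by
    refine tendsto_const_nhds.congr' ?_
    filter_upwards [eventually_ge_atTop M] with i hi
    rw [hM i hi, hM (i + 1) (by omega), Function.iterate_succ_apply', dist_self])
  refine ⟨z, hx0 ▸ hz 0, hz'.congr' ?_⟩
  filter_upwards [eventually_ge_atTop M] with i hi
  rw [hM i hi]

end Chains

/-- Theorem 1.2: a single `(ℱ,𝒢)`-δ-scrambled n-tuple in `[V^s(D)]ⁿ` makes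
`V^s(D)` dense `(ℱ,𝒢)`-n-r-chaotic for every `0 < r < δ`. -/
theorem dense_chaos_of_scrambled_tuple
    {X : Type*} [MetricSpace X] [CompactSpace X]
    (f : X → X) (hf : Continuous f) (hsls : SLimitShadowing f)
    (C : Set X) (hC : IsChainComponent f C) (D : Set X) (hD : D ∈ DClasses f C)
    (F G : Set (Set ℕ)) (hF : FurstenbergFamily F) (hFfull : FullFamily F)
    (hG : FurstenbergFamily G) (hGfull : FullFamily G)
    (n : ℕ) (hn : 2 ≤ n) (δ : ℝ) (hδ : 0 < δ)
    (a : Fin n → X) (ha : ∀ j, a j ∈ vStable f C D) (hsc : Scrambled f F G δ a) :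
    ∀ r : ℝ, 0 < r → r < δ → DenseChaotic f F G n r (vStable f C D) := by
  intro r _ hrδ y hy
  refine Metric.mem_closure_iff.2 fun ε hε => ?_
  choose z hzy hza using fun j =>
    exists_asymptotic_near hC hf hsls hD (hy j) (ha j) (half_pos hε)
  refine ⟨z, ⟨fun j => vStable_of_asymptotic (ha j) (hza j),
    hsc.of_asymptotic hF hFfull hG hGfull hrδ hza⟩, ?_⟩
  rw [dist_comm]
  exact ((dist_pi_le_iff (half_pos hε).le).2 hzy).trans_lt (half_lt_self hε)
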